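/- Let η be a finite index set, x ∉ η, let ξ ⊆ η, and let M be a Hermitian positive definite matrix indexed by η ∪ {x}. Then det(M restricted to (ξ∪{x}) × (ξ∪{x})) · det(M restricted to η × η) ≥ det(M restricted to (η∪{x}) × (η∪{x})) · det(M restricted to ξ × ξ). Equivalently, the ratio det M[ζ∪{x}]/det M[ζ] is nonincreasing as the subset ζ grows (Koteljanskii's inequality). -/

import Mathlib

open Matrix
open scoped ComplexOrder

/-- The principal submatrix of `M : Matrix S S ℂ` with rows and columns indexed by a
subset `T ⊆ S`. -/
def Matrix.restrictIdx {ι : Type*} {S : Finset ι} (M : Matrix (↥S) (↥S) ℂ)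
    (T : Finset ι) (h : T ⊆ S) : Matrix (↥T) (↥T) ℂ :=
  M.submatrix (fun i => ⟨i.1, h i.2⟩) (fun j => ⟨j.1, h j.2⟩)

/-- Inverting a compression of a positive definite matrix and extending back gives at most the
inverse of the matrix, in the Loewner order. -/
lemma Matrix.PosDef.posSemidef_inv_sub_compression {𝕜 m l : Type*} [RCLike 𝕜] [Fintype m]
    [Fintype l] [DecidableEq m] [DecidableEq l] {A : Matrix m m 𝕜} (hA : A.PosDef)
    {E : Matrix m l 𝕜} (hE : (Eᴴ * A * E).PosDef) :
    (A⁻¹ - E * (Eᴴ * A * E)⁻¹ * Eᴴ).PosSemidef := by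
  let := hA.inv.isUnit.invertible
  let := hE.isUnit.invertible
  rw [← PosDef.fromBlocks₂₂ _ _ hE, PosDef.fromBlocks₁₁ _ _ hA.inv,
    nonsing_inv_nonsing_inv A ((isUnit_iff_isUnit_det A).1 hA.isUnit), sub_self]
  exact PosSemidef.zero

/-- Koteljanskii's inequality for a block matrix whose last block is `1 × 1`. -/
lemma Matrix.PosDef.det_fromBlocks_mul_det_submatrix_le {𝕜 m l : Type*} [RCLike 𝕜]
    [Fintype m] [Fintype l] [DecidableEq m] [DecidableEq l] {A : Matrix m m 𝕜} (hA : A.PosDef)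
    (B : Matrix m Unit 𝕜) (D : Matrix Unit Unit 𝕜) {e : l → m} (he : Function.Injective e) :
    (fromBlocks A B Bᴴ D).det * (A.submatrix e e).det ≤
      (fromBlocks (A.submatrix e e) (B.submatrix e id) (B.submatrix e id)ᴴ D).det * A.det := by
  set E : Matrix m l 𝕜 := (1 : Matrix m m 𝕜).submatrix id e with hEdef
  have hEH : Eᴴ = (1 : Matrix m m 𝕜).submatrix e id := by
    rw [hEdef, conjTranspose_submatrix, conjTranspose_one]
  have hAE : A.submatrix e e = Eᴴ * A * E := by
    rw [hEH, hEdef]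
    ext i j
    simp [Matrix.mul_apply, Matrix.one_apply]
  have hBE : B.submatrix e id = Eᴴ * B := by
    rw [hEH]
    ext i j
    simp [Matrix.mul_apply, Matrix.one_apply]
  have hA' : (A.submatrix e e).PosDef := hA.submatrix he
  let := hA.isUnit.invertible
  let := hA'.isUnit.invertible
  have key := ((hA.posSemidef_inv_sub_compression
    (hAE ▸ hA')).conjTranspose_mul_mul_same B).diag_nonneg (i := ())
  have schur_le : (D - Bᴴ * A⁻¹ * B) () () ≤
      (D - (B.submatrix e id)ᴴ * (A.submatrix e e)⁻¹ * B.submatrix e id) () () := by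
    rw [← sub_nonneg, ← sub_apply, hAE, hBE, sub_sub_sub_cancel_left]
    simpa only [conjTranspose_mul, conjTranspose_conjTranspose, Matrix.mul_sub, Matrix.sub_mul,
      Matrix.mul_assoc] using key
  rw [det_fromBlocks₁₁, det_fromBlocks₁₁, invOf_eq_nonsing_inv, invOf_eq_nonsing_inv,
    det_unique (D - Bᴴ * A⁻¹ * B), det_unique (D - _ * _ * _)]
  calc _ = A.det * (A.submatrix e e).det * (D - Bᴴ * A⁻¹ * B) () () := by
        rw [mul_right_comm]
    _ ≤ A.det * (A.submatrix e e).det *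
        (D - (B.submatrix e id)ᴴ * (A.submatrix e e)⁻¹ * B.submatrix e id) () () :=
      mul_le_mul_of_nonneg_left schur_le (mul_nonneg hA.det_pos.le hA'.det_pos.le)
    _ = _ := by rw [mul_comm A.det, mul_right_comm]

/-- The determinant of a Hermitian matrix indexed by `insert x ζ`, with the index `x` split off. -/
lemma Matrix.IsHermitian.det_insert_eq_det_fromBlocks {𝕜 ι : Type*} [RCLike 𝕜] [DecidableEq ι]
    {ζ : Finset ι} {x : ι} (hx : x ∉ ζ)
    {N : Matrix (↥(insert x ζ)) (↥(insert x ζ)) 𝕜} (hN : N.IsHermitian) :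
    N.det = (Matrix.fromBlocks
      (N.submatrix (fun i : ζ => ⟨i.1, Finset.mem_insert_of_mem i.2⟩)
        (fun i : ζ => ⟨i.1, Finset.mem_insert_of_mem i.2⟩))
      (N.submatrix (fun i : ζ => ⟨i.1, Finset.mem_insert_of_mem i.2⟩)
        (fun _ : Unit => ⟨x, Finset.mem_insert_self x ζ⟩))
      (N.submatrix (fun i : ζ => ⟨i.1, Finset.mem_insert_of_mem i.2⟩)
        (fun _ : Unit => ⟨x, Finset.mem_insert_self x ζ⟩))ᴴ
      (N.submatrix (fun _ : Unit => ⟨x, Finset.mem_insert_self x ζ⟩)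
        (fun _ : Unit => ⟨x, Finset.mem_insert_self x ζ⟩))).det := by
  rw [← det_submatrix_equiv_self
    ((Finset.subtypeInsertEquivOption hx).trans (Equiv.optionEquivSumPUnit _)).symm N]
  refine congrArg det ?_
  ext (i | i) (j | j)
  · rfl
  · rfl
  · exact (hN.apply _ _).symm
  · rfl

/-- Koteljanskii's inequality: for a Hermitian positive definite matrix `M` indexed by
`insert x η` with `x ∉ η` and `ξ ⊆ η`,
`det M[ξ ∪ {x}] * det M[η] ≥ det M[η ∪ {x}] * det M[ξ]`; equivalently, the ratio
`det M[ζ ∪ {x}] / det M[ζ]` is nonincreasing in `ζ`. -/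
theorem koteljanskii_inequality {ι : Type*} [DecidableEq ι]
    (η ξ : Finset ι) (x : ι) (hx : x ∉ η) (hξη : ξ ⊆ η)
    (M : Matrix (↥(insert x η)) (↥(insert x η)) ℂ) (hM : M.PosDef) :
    (M.restrictIdx (insert x ξ) (Finset.insert_subset_insert x hξη)).det *
      (M.restrictIdx η (Finset.subset_insert x η)).det ≥
    (M.restrictIdx (insert x η) (Finset.Subset.refl _)).det *
      (M.restrictIdx ξ (hξη.trans (Finset.subset_insert x η))).det := by
  have hξx : x ∉ ξ := fun h => hx (hξη h)
  have hξ : (M.restrictIdx (insert x ξ) (Finset.insert_subset_insert x hξη)).IsHermitian :=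
    hM.isHermitian.submatrix _
  have hη : (M.restrictIdx (insert x η) (Finset.Subset.refl _)).IsHermitian :=
    hM.isHermitian.submatrix _
  have hA : (M.restrictIdx η (Finset.subset_insert x η)).PosDef :=
    hM.submatrix fun i j h => Subtype.ext (congrArg (fun k => k.1) h)
  rw [hξ.det_insert_eq_det_fromBlocks hξx, hη.det_insert_eq_det_fromBlocks hx]
  exact hA.det_fromBlocks_mul_det_submatrix_le _ _
    (e := fun i : ξ => (⟨i.1, hξη i.2⟩ : η))
    fun i j h => Subtype.ext (congrArg (fun k => k.1) h)
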